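/- Let $M_n = \frac{3\cdot 6^n}{(n+2)(n+1)}\binom{2n}{n}$ and $C_n = \frac{2^{2n+1}\,(3n)!!}{(n+2)!\; n!!}$, where $k!! = k(k-2)(k-4)\cdots$ denotes the double factorial. Then $\frac{M_n}{C_n}$ is asymptotically $\frac{\sqrt{6}}{2}\left(\frac{2\sqrt{3}}{3}\right)^n$; that is, $\lim_{n\to\infty} \frac{M_n}{C_n}\cdot\left(\frac{3}{2\sqrt{3}}\right)^n = \frac{\sqrt{6}}{2}$. -/

import Mathlib

open Filter Real Nat

/-- Convergence along the even and the odd naturals gives convergence. -/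
lemma tendsto_atTop_of_even_of_odd {α : Type*} {f : ℕ → α} {l : Filter α}
    (he : Tendsto (fun m => f (2 * m)) atTop l)
    (ho : Tendsto (fun m => f (2 * m + 1)) atTop l) : Tendsto f atTop l := by
  intro s hs
  obtain ⟨a, ha⟩ := mem_atTop_sets.1 (he hs)
  obtain ⟨b, hb⟩ := mem_atTop_sets.1 (ho hs)
  refine mem_atTop_sets.2 ⟨2 * (a + b) + 1, fun n hn => ?_⟩
  obtain ⟨m, rfl | rfl⟩ := Nat.even_or_odd' n
  · exact ha m (by omega)
  · exact hb m (by omega)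

/-- Factorials of multiples of `m` in terms of the Stirling sequence. -/
lemma factorial_mul_eq_stirlingSeq (k : ℕ) {m : ℕ} (hk : k ≠ 0) (hm : m ≠ 0) :
    ((k * m)! : ℝ) = Stirling.stirlingSeq (k * m) * √k * √(2 * m) *
      ((k : ℝ) ^ k) ^ m * ((m / exp 1) ^ m) ^ k := by
  have h1 : √(2 * ((k * m : ℕ) : ℝ)) = √k * √(2 * m) := by
    rw [← Real.sqrt_mul (Nat.cast_nonneg k)]; push_cast; ring_nf
  have h2 : (((k * m : ℕ) : ℝ) / exp 1) ^ (k * m) =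
      ((k : ℝ) ^ k) ^ m * ((m / exp 1) ^ m) ^ k := by
    rw [← pow_mul, ← pow_mul, mul_comm m k, ← mul_pow]; push_cast; ring_nf
  have hk' : (0 : ℝ) < k := by positivity
  have hm' : (0 : ℝ) < m := by positivity
  rw [Stirling.stirlingSeq, h1, h2]
  field_simp

lemma tendsto_stirlingSeq_mul {k : ℕ} (hk : k ≠ 0) :
    Tendsto (fun m => Stirling.stirlingSeq (k * m)) atTop (nhds (√π)) :=
  Stirling.tendsto_stirlingSeq_sqrt_pi.comp (tendsto_id.const_mul_atTop' (Nat.pos_of_ne_zero hk))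

lemma stirlingSeq_pos {n : ℕ} (hn : n ≠ 0) : 0 < Stirling.stirlingSeq n := by
  obtain ⟨k, rfl⟩ := Nat.exists_eq_succ_of_ne_zero hn
  exact Stirling.stirlingSeq'_pos k

lemma tendsto_factorial_ratio_even :
    Tendsto (fun m : ℕ => (27 / 64 : ℝ) ^ m *
      (((4 * m)! : ℝ) * (m ! : ℝ) / (((2 * m)! : ℝ) * ((3 * m)! : ℝ))))
      atTop (nhds (√4 / (√2 * √3))) := by
  have h := (((tendsto_stirlingSeq_mul (k := 4) (by norm_num)).mul
    (tendsto_stirlingSeq_mul (k := 1) (by norm_num))).div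
    ((tendsto_stirlingSeq_mul (k := 2) (by norm_num)).mul
    (tendsto_stirlingSeq_mul (k := 3) (by norm_num))) (by positivity)).mul_const (√4 / (√2 * √3))
  rw [div_self (by positivity), one_mul] at h
  refine h.congr' ?_
  filter_upwards [eventually_ne_atTop 0] with m hm
  have e1 := factorial_mul_eq_stirlingSeq 1 one_ne_zero hm
  have e2 := factorial_mul_eq_stirlingSeq 2 two_ne_zero hm
  have e3 := factorial_mul_eq_stirlingSeq 3 three_ne_zero hm
  have e4 := factorial_mul_eq_stirlingSeq 4 four_ne_zero hm
  have p2 := stirlingSeq_pos (n := 2 * m) (by omega)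
  have p3 := stirlingSeq_pos (n := 3 * m) (by omega)
  have hm' : (0 : ℝ) < m := by positivity
  have hP : 0 < ((m : ℝ) / exp 1) ^ m := by positivity
  have hpow : (27 / 64 : ℝ) ^ m * (4 ^ 4) ^ m = (2 ^ 2) ^ m * (3 ^ 3) ^ m := by
    rw [← mul_pow, ← mul_pow]; norm_num
  simp only [one_mul, Nat.cast_one, Real.sqrt_one, one_pow, mul_one, pow_one] at e1
  push_cast at e2 e3 e4
  rw [e1, e2, e3, e4]
  simp only [Pi.div_apply, one_mul]
  generalize ((m : ℝ) / exp 1) ^ m = P at *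
  have hq : 0 < √(2 * (m : ℝ)) := by positivity
  generalize √(2 * (m : ℝ)) = q at *
  rw [_root_.div_mul_div_comm, ← mul_div_assoc, div_eq_div_iff (by positivity) (by positivity)]
  linear_combination (-(Stirling.stirlingSeq (4 * m) * Stirling.stirlingSeq m *
    Stirling.stirlingSeq (2 * m) * Stirling.stirlingSeq (3 * m) * √4 * √2 * √3 * q ^ 2 * P ^ 5)) * hpow

lemma tendsto_factorial_ratio_odd :
    Tendsto (fun m : ℕ => (27 / 4 : ℝ) ^ m *
      (((4 * m)! : ℝ) * ((3 * m)! : ℝ) / ((m ! : ℝ) * ((6 * m)! : ℝ))))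
      atTop (nhds (√4 * √3 / √6)) := by
  have h := (((tendsto_stirlingSeq_mul (k := 4) (by norm_num)).mul
    (tendsto_stirlingSeq_mul (k := 3) (by norm_num))).div
    ((tendsto_stirlingSeq_mul (k := 1) (by norm_num)).mul
    (tendsto_stirlingSeq_mul (k := 6) (by norm_num))) (by positivity)).mul_const (√4 * √3 / √6)
  rw [div_self (by positivity), one_mul] at h
  refine h.congr' ?_
  filter_upwards [eventually_ne_atTop 0] with m hm
  have e1 := factorial_mul_eq_stirlingSeq 1 one_ne_zero hm
  have e6 := factorial_mul_eq_stirlingSeq 6 (by norm_num) hm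
  have e3 := factorial_mul_eq_stirlingSeq 3 three_ne_zero hm
  have e4 := factorial_mul_eq_stirlingSeq 4 four_ne_zero hm
  have p1 := stirlingSeq_pos (n := m) (by omega)
  have p6 := stirlingSeq_pos (n := 6 * m) (by omega)
  have hm' : (0 : ℝ) < m := by positivity
  have hP : 0 < ((m : ℝ) / exp 1) ^ m := by positivity
  have hpow : (27 / 4 : ℝ) ^ m * (4 ^ 4) ^ m * (3 ^ 3) ^ m = (6 ^ 6) ^ m := by
    rw [← mul_pow, ← mul_pow]; norm_num
  simp only [one_mul, Nat.cast_one, Real.sqrt_one, one_pow, mul_one, pow_one] at e1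
  push_cast at e6 e3 e4
  rw [e1, e6, e3, e4]
  simp only [Pi.div_apply, one_mul]
  generalize ((m : ℝ) / exp 1) ^ m = P at *
  have hq : 0 < √(2 * (m : ℝ)) := by positivity
  generalize √(2 * (m : ℝ)) = q at *
  rw [_root_.div_mul_div_comm, ← mul_div_assoc, div_eq_div_iff (by positivity) (by positivity)]
  linear_combination (-(Stirling.stirlingSeq (4 * m) * Stirling.stirlingSeq m *
    Stirling.stirlingSeq (6 * m) * Stirling.stirlingSeq (3 * m) * √4 * √6 * √3 * q ^ 2 * P ^ 7)) * hpow

lemma ratio_eq_doubleFactorial (n : ℕ) :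
    ((3 * 6 ^ n * (Nat.choose (2 * n) n) : ℝ) / ((n + 2) * (n + 1)))
          / ((2 ^ (2 * n + 1) * (Nat.doubleFactorial (3 * n)) : ℝ)
              / ((Nat.factorial (n + 2)) * (Nat.doubleFactorial n)))
      = 3 / 2 * (3 / 2) ^ n * ((2 * n)! * n‼ / (n ! * (3 * n)‼)) := by
  have hc : ((Nat.choose (2 * n) n : ℕ) : ℝ) = (2 * n)! / (n ! * n !) := by
    rw [Nat.cast_choose ℝ (by omega : n ≤ 2 * n), two_mul, Nat.add_sub_cancel]
  have hf : ((n + 2)! : ℝ) = (n + 2) * (n + 1) * n ! := by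
    rw [Nat.factorial_succ, Nat.factorial_succ]; push_cast; ring
  have h6 : (6 : ℝ) ^ n = (3 / 2) ^ n * 2 ^ (2 * n) := by
    rw [pow_mul, ← mul_pow]; norm_num
  have := Nat.doubleFactorial_pos (3 * n)
  have := Nat.factorial_pos n
  rw [hc, hf, h6, pow_succ]
  generalize ((3 : ℝ) / 2) ^ n = c
  field_simp

lemma three_div_two_mul_sqrt_three : (3 : ℝ) / (2 * √3) = √3 / 2 := by
  have h : √3 * √3 = (3 : ℝ) := Real.mul_self_sqrt (by norm_num)
  rw [div_eq_div_iff (by positivity) (by norm_num)]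
  linear_combination (-2) * h

lemma doubleFactorial_two_mul_add_one_cast (n : ℕ) :
    ((2 * n + 1)‼ : ℝ) = (2 * n + 1)! / (2 ^ n * n !) := by
  rw [Nat.factorial_eq_mul_doubleFactorial, Nat.doubleFactorial_two_mul]
  push_cast
  field_simp

/-- With `M_n = 3·6ⁿ·C(2n,n)/((n+2)(n+1))` and `C_n = 2^{2n+1}·(3n)‼/((n+2)!·n‼)`,
the ratio `M_n/C_n` (the expected number of perfect matchings in a random rooted
cubic planar map) satisfies `M_n/C_n ∼ (√6/2)·(2√3/3)ⁿ`. -/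
theorem stmt_5 :
    Tendsto
      (fun n : ℕ =>
        ((3 * 6 ^ n * (Nat.choose (2 * n) n) : ℝ) / ((n + 2) * (n + 1)))
          / ((2 ^ (2 * n + 1) * (Nat.doubleFactorial (3 * n)) : ℝ)
              / ((Nat.factorial (n + 2)) * (Nat.doubleFactorial n)))
          * ((3 : ℝ) / (2 * Real.sqrt 3)) ^ n)
      atTop (nhds (Real.sqrt 6 / 2)) := by
  have s3 : √3 ^ 2 = (3 : ℝ) := Real.sq_sqrt (by norm_num)
  have s2 : √2 ^ 2 = (2 : ℝ) := Real.sq_sqrt (by norm_num)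
  have s6 : √6 = √2 * √3 := by rw [← Real.sqrt_mul (by norm_num)]; norm_num
  have s4 : √4 = (2 : ℝ) := by
    rw [show (4 : ℝ) = 2 ^ 2 by norm_num, Real.sqrt_sq (by norm_num)]
  simp only [ratio_eq_doubleFactorial, three_div_two_mul_sqrt_three]
  refine tendsto_atTop_of_even_of_odd ?_ ?_
  · have h := tendsto_factorial_ratio_even.const_mul (3 / 2 : ℝ)
    have hl : 3 / 2 * (√4 / (√2 * √3)) = √6 / 2 := by
      rw [s4, s6]; field_simp; rw [s2, s3]; norm_num
    rw [hl] at h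
    refine h.congr fun m => ?_
    have hpow : (3 / 2 : ℝ) ^ (2 * m) * (√3 / 2) ^ (2 * m) = (27 / 64) ^ m * (2 ^ 2) ^ m := by
      rw [pow_mul, pow_mul, div_pow √3, s3, ← mul_pow, ← mul_pow]; norm_num
    rw [show 3 * (2 * m) = 2 * (3 * m) by ring, Nat.doubleFactorial_two_mul,
      Nat.doubleFactorial_two_mul, show 2 * (2 * m) = 4 * m by ring]
    push_cast
    rw [mul_right_comm, mul_assoc (3 / 2 : ℝ) (_ ^ _), hpow, pow_mul', ← pow_mul 2 2 m, pow_mul' 2 2 m]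
    field_simp
  · have hr : Tendsto (fun m : ℕ => (((4 + 2 * (m : ℝ)⁻¹) * (4 + (m : ℝ)⁻¹) * (3 + (m : ℝ)⁻¹)) /
        ((6 + 3 * (m : ℝ)⁻¹) * (6 + 2 * (m : ℝ)⁻¹) * (6 + (m : ℝ)⁻¹)))) atTop (nhds (2 / 9)) := by
      have hi : Tendsto (fun m : ℕ => (m : ℝ)⁻¹) atTop (nhds 0) :=
        tendsto_inv_atTop_nhds_zero_nat
      have hc : ContinuousAt (fun x : ℝ => ((4 + 2 * x) * (4 + x) * (3 + x)) /
          ((6 + 3 * x) * (6 + 2 * x) * (6 + x))) 0 := by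
        refine ContinuousAt.div (by fun_prop) (by fun_prop) (by norm_num)
      have := hc.tendsto.comp hi
      norm_num at this
      exact this
    have h := (tendsto_factorial_ratio_odd.mul hr).const_mul (9 * √3 / 4)
    have hl : 9 * √3 / 4 * (√4 * √3 / √6 * (2 / 9)) = √6 / 2 := by
      rw [s4, s6]; field_simp; rw [s2]; norm_num
    rw [hl] at h
    refine h.congr' ?_
    filter_upwards [eventually_ne_atTop 0] with m hm
    have hm' : (0 : ℝ) < m := by positivity
    have hpow : (3 / 2 : ℝ) ^ (2 * m + 1) * (√3 / 2) ^ (2 * m + 1) * (2 ^ 2) ^ m =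
        3 * √3 / 4 * (27 / 4) ^ m := by
      rw [pow_succ, pow_succ, pow_mul, pow_mul, div_pow √3, s3]
      rw [show (27 / 4 : ℝ) = (3 / 2) ^ 2 * (3 / 2 ^ 2) * 2 ^ 2 by norm_num, mul_pow, mul_pow]
      ring
    have f4 : ((4 * m + 2)! : ℝ) = (4 * m + 2) * (4 * m + 1) * (4 * m)! := by
      rw [Nat.factorial_succ, Nat.factorial_succ]; push_cast; ring
    have f3 : ((3 * m + 1)! : ℝ) = (3 * m + 1) * (3 * m)! := by
      rw [Nat.factorial_succ]; push_cast; ring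
    have f6 : ((6 * m + 3)! : ℝ) = (6 * m + 3) * (6 * m + 2) * (6 * m + 1) * (6 * m)! := by
      rw [Nat.factorial_succ, Nat.factorial_succ, Nat.factorial_succ]; push_cast; ring
    have hp : (2 : ℝ) ^ (3 * m + 1) = 2 * (2 ^ 2) ^ m * 2 ^ m := by
      rw [← pow_mul]; ring
    rw [show 3 * (2 * m + 1) = 2 * (3 * m + 1) + 1 by ring,
      doubleFactorial_two_mul_add_one_cast, doubleFactorial_two_mul_add_one_cast,
      show 2 * (3 * m + 1) + 1 = 6 * m + 3 by ring, show 2 * (2 * m + 1) = 4 * m + 2 by ring,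
      f4, f3, f6, hp, mul_right_comm (3 / 2 * (3 / 2 : ℝ) ^ _), mul_assoc (3 / 2 : ℝ)]
    have key : (3 / 2 : ℝ) ^ (2 * m + 1) * (√3 / 2) ^ (2 * m + 1) =
        3 * √3 / 4 * (27 / 4) ^ m / (2 ^ 2) ^ m := by
      rw [← hpow]; field_simp
    rw [key]
    generalize (27 / 4 : ℝ) ^ m = c
    field_simp
    ring
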